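/- arXiv:2010.03166 — 3 statements merged into one kernel-verified Lean document; each statement's English description precedes it below -/
import Mathlib

section
/- Let η > 1 and d > 0 be real numbers and let the modeled per-subgraph sampling cost on p processors (with COST_mem = COST_rand = 1) be T(p) = 1/(1 − (1 − 1/η)^p) + (d/p)·(2 + 1/(η − 1)), so that the serial cost is T(1) = η + d·(2 + 1/(η − 1)). Then for every ε > 0 and every integer p with 1 ≤ p ≤ ε·d·(2 + 1/(η − 1)) − η, the speedup satisfies T(1)/T(p) ≥ p/(1 + ε). -/
/-- By Bernoulli's inequality, `(1 - x) ^ n * (1 + n * x) ≤ (1 - x ^ 2) ^ n ≤ 1`. -/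
lemma one_sub_pow_mul_one_add_mul_le_one {x : ℝ} (hx0 : 0 ≤ x) (hx1 : x ≤ 1) (n : ℕ) :
    (1 - x) ^ n * (1 + n * x) ≤ 1 := by
  have bernoulli : 1 + n * x ≤ (1 + x) ^ n := one_add_mul_le_pow (by linarith) n
  calc (1 - x) ^ n * (1 + n * x) ≤ (1 - x) ^ n * (1 + x) ^ n :=
        mul_le_mul_of_nonneg_left bernoulli (pow_nonneg (by linarith) n)
    _ = ((1 - x) * (1 + x)) ^ n := (mul_pow _ _ _).symm
    _ ≤ 1 := pow_le_one₀ (mul_nonneg (by linarith) (by linarith)) (by nlinarith)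

/-- The expected number of probing rounds of `n` processors with success probability `1 / η`
each is at most `1 + η / n`. -/
lemma mul_one_div_one_sub_pow_le {η : ℝ} (hη : 1 < η) {n : ℕ} (hn : 1 ≤ n) :
    0 < 1 - (1 - 1 / η) ^ n ∧ n * (1 / (1 - (1 - 1 / η) ^ n)) ≤ n + η := by
  have hη0 : 0 < η := by linarith
  have hx1 : 1 / η < 1 := (div_lt_one hη0).2 hη
  have hx0 : 0 < 1 / η := by positivity
  have hlt : (1 - 1 / η) ^ n < 1 := pow_lt_one₀ (by linarith) (by linarith) (by omega)
  have hpos : 0 < 1 - (1 - 1 / η) ^ n := by linarith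
  have key := one_sub_pow_mul_one_add_mul_le_one hx0.le hx1.le n
  refine ⟨hpos, ?_⟩
  rw [mul_one_div, div_le_iff₀ hpos]
  generalize (1 - 1 / η) ^ n = q at key
  have hmul := mul_le_mul_of_nonneg_right key hη0.le
  have heq : q * (1 + n * (1 / η)) * η = q * (η + n) := by field_simp
  linarith

/-- Scalability of the Dashboard-based parallel frontier sampler:
for η > 1, d > 0, with per-subgraph cost
T(p) = 1/(1 − (1 − 1/η)^p) + (d/p)·(2 + 1/(η − 1)) and serial cost
T(1) = η + d·(2 + 1/(η − 1)), for every ε > 0 and every integer p with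
1 ≤ p ≤ ε·d·(2 + 1/(η − 1)) − η, the speedup T(1)/T(p) is at least p/(1 + ε). -/
theorem frontier_sampler_scalability
    (η d : ℝ) (hη : 1 < η) (hd : 0 < d)
    (ε : ℝ) (hε : 0 < ε)
    (p : ℕ) (hp : 1 ≤ p)
    (hple : (p : ℝ) ≤ ε * d * (2 + 1 / (η - 1)) - η) :
    (η + d * (2 + 1 / (η - 1))) /
      (1 / (1 - (1 - 1 / η) ^ p) + (d / (p : ℝ)) * (2 + 1 / (η - 1)))
      ≥ (p : ℝ) / (1 + ε) := by
  have hp0 : (0 : ℝ) < p := by exact_mod_cast hp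
  have hη1 : 0 < η - 1 := by linarith
  obtain ⟨hpos, hF⟩ := mul_one_div_one_sub_pow_le hη hp
  have hC : 0 < 2 + 1 / (η - 1) := by positivity
  have hF0 : 0 < 1 / (1 - (1 - 1 / η) ^ p) := by positivity
  generalize 2 + 1 / (η - 1) = C at *
  generalize 1 / (1 - (1 - 1 / η) ^ p) = F at *
  have hden : 0 < F + d / p * C := by positivity
  rw [ge_iff_le, div_le_div_iff₀ (by linarith) hden]
  have hexp : p * (F + d / p * C) = p * F + d * C := by field_simp
  have hεη : 0 < η * ε := mul_pos (by linarith) hε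
  rw [hexp]
  linarith
end

section
/- Let η > 1 and d > 0 be real numbers and let T(p) = 1/(1 − (1 − 1/η)^p) + (d/p)·(2 + 1/(η − 1)) with serial cost T(1) = η + d·(2 + 1/(η − 1)). Then for every integer p with 1 ≤ p ≤ d − η, the speedup satisfies T(1)/T(p) ≥ p/1.5. (In particular, d − η ≤ (1/2)·d·(2 + 1/(η − 1)) − η, so this is the instance ε = 1/2 of the scalability theorem.) -/
/-- The expected number of rounds of `p` parallel probes, each succeeding with probability `1 / η`,
is at most `(p + η - 1) / p`. -/
theorem one_div_one_sub_pow_le {η : ℝ} (hη : 1 < η) {p : ℕ} (hp : 1 ≤ p) :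
    0 < 1 - (1 - 1 / η) ^ p ∧ 1 / (1 - (1 - 1 / η) ^ p) ≤ (p + η - 1) / p := by
  have h1 : 0 < η - 1 := by linarith
  have h0 : 0 < η := by linarith
  have hp0 : (0 : ℝ) < p := by exact_mod_cast hp
  have hs : 0 < p + η - 1 := by linarith
  have hq : 0 < 1 - 1 / η := by
    rw [one_sub_div h0.ne']; positivity
  have hinv : (1 - 1 / η) * (1 + 1 / (η - 1)) = 1 := by
    field_simp; ring
  have bernoulli : 1 + (p : ℝ) * (1 / (η - 1)) ≤ (1 + 1 / (η - 1)) ^ p :=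
    one_add_mul_le_pow (by linarith [one_div_pos.mpr h1]) p
  have hx : (1 - 1 / η) ^ p * (1 + (p : ℝ) * (1 / (η - 1))) ≤ 1 := by
    calc _ ≤ (1 - 1 / η) ^ p * (1 + 1 / (η - 1)) ^ p := by gcongr
      _ = 1 := by rw [← mul_pow, hinv, one_pow]
  have hx' : (1 - 1 / η) ^ p * (p + η - 1) ≤ η - 1 := by
    have := mul_le_mul_of_nonneg_right hx h1.le
    have e : (1 + (p : ℝ) * (1 / (η - 1))) * (η - 1) = p + η - 1 := by
      field_simp; ring
    rwa [mul_assoc, e, one_mul] at this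
  have key : p / (p + η - 1) ≤ 1 - (1 - 1 / η) ^ p := by
    rw [div_le_iff₀ hs]; linarith
  have hpos : 0 < p / (p + η - 1) := by positivity
  refine ⟨hpos.trans_le key, ?_⟩
  simpa using one_div_le_one_div_of_le hpos key

/-- Instance ε = 1/2 of the scalability theorem for the Dashboard-based
parallel frontier sampler: for η > 1, d > 0 and integer p with
1 ≤ p ≤ d − η, the speedup T(1)/T(p) is at least p/1.5, where
T(p) = 1/(1 − (1 − 1/η)^p) + (d/p)·(2 + 1/(η − 1)) and
T(1) = η + d·(2 + 1/(η − 1)).  In particular,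
d − η ≤ (1/2)·d·(2 + 1/(η − 1)) − η. -/
theorem frontier_sampler_scalability_half
    (η d : ℝ) (hη : 1 < η) (hd : 0 < d)
    (p : ℕ) (hp : 1 ≤ p)
    (hple : (p : ℝ) ≤ d - η) :
    (η + d * (2 + 1 / (η - 1))) /
      (1 / (1 - (1 - 1 / η) ^ p) + (d / (p : ℝ)) * (2 + 1 / (η - 1)))
      ≥ (p : ℝ) / 1.5
    ∧ d - η ≤ (1 / 2) * d * (2 + 1 / (η - 1)) - η := by
  have h1 : 0 < η - 1 := by linarith
  have hp0 : (0 : ℝ) < p := by exact_mod_cast hp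
  obtain ⟨hpos, hle⟩ := one_div_one_sub_pow_le hη hp
  have hK : 0 < 1 / (η - 1) := one_div_pos.mpr h1
  have hdK : 0 < d * (1 / (η - 1)) := mul_pos hd hK
  refine ⟨?_, by linarith⟩
  have hden : 0 < 1 / (1 - (1 - 1 / η) ^ p) + (d / (p : ℝ)) * (2 + 1 / (η - 1)) := by
    positivity
  rw [ge_iff_le, le_div_iff₀ hden]
  have hmul : p * (1 / (1 - (1 - 1 / η) ^ p)) ≤ p + η - 1 := by
    rwa [le_div_iff₀' hp0] at hle
  have hcancel : p * ((d / (p : ℝ)) * (2 + 1 / (η - 1))) = d * (2 + 1 / (η - 1)) := by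
    rw [← mul_assoc, mul_div_cancel₀ d hp0.ne']
  rw [div_mul_eq_mul_div, div_le_iff₀ (by norm_num), mul_add, hcancel]
  linarith
end

section
/- Let n, d, f, p, S be positive reals with p ≤ 4·f/d and 2·n·d ≤ S, and set Q_f* = max{p, 8·n·f/S}. Then the no-graph-partitioning solution (Q_v, Q_f) = (1, Q_f*), which has γ_v = 1 and cost g_comm(1, Q_f*) = 2·Q_f*·n·d + 8·n·f, satisfies g_comm(1, Q_f*) ≤ 16·n·f, while every choice of reals Q_v ≥ 1, Q_f ≥ 1 and γ_v ≥ 1/Q_v has cost g_comm(Q_v, Q_f) = 2·Q_f·n·d + 8·Q_v·n·f·γ_v ≥ 8·n·f. Consequently g_comm(1, Q_f*) is at most 2 times the cost of any (in particular the optimal) partitioning, i.e., taking Q_v = 1 and Q_f = max{p, 8nf/S_cache} is a 2-approximation of the communication minimization problem. -/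
/-- 2-approximation of the communication minimization problem: for positive
n, d, f, p, S with p ≤ 4·f/d and 2·n·d ≤ S, the no-graph-partitioning
solution (Q_v, Q_f) = (1, Q_f*) with Q_f* = max{p, 8·n·f/S} (and γ_v = 1)
has cost g_comm(1, Q_f*) = 2·Q_f*·n·d + 8·n·f ≤ 16·n·f, while every choice
of Q_v ≥ 1, Q_f ≥ 1, γ_v ≥ 1/Q_v has cost
g_comm(Q_v, Q_f) = 2·Q_f·n·d + 8·Q_v·n·f·γ_v ≥ 8·n·f; consequently
g_comm(1, Q_f*) is at most 2 times the cost of any partitioning. -/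
theorem feature_partition_two_approx
    (n d f p S : ℝ) (hn : 0 < n) (hd : 0 < d) (hf : 0 < f) (hp : 0 < p)
    (hS : 0 < S) (hple : p ≤ 4 * f / d) (hcache : 2 * n * d ≤ S) :
    (2 * max p (8 * n * f / S) * n * d + 8 * n * f ≤ 16 * n * f) ∧
    (∀ Qv Qf γv : ℝ, 1 ≤ Qv → 1 ≤ Qf → γv ≥ 1 / Qv →
      2 * Qf * n * d + 8 * Qv * n * f * γv ≥ 8 * n * f) ∧
    (∀ Qv Qf γv : ℝ, 1 ≤ Qv → 1 ≤ Qf → γv ≥ 1 / Qv →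
      2 * max p (8 * n * f / S) * n * d + 8 * n * f ≤
        2 * (2 * Qf * n * d + 8 * Qv * n * f * γv)) := by
  have hmax : max p (8 * n * f / S) ≤ 4 * f / d := by
    refine max_le hple ?_
    rw [div_le_div_iff₀ hS hd]
    nlinarith [mul_le_mul_of_nonneg_left hcache hf.le]
  have hupper : 2 * max p (8 * n * f / S) * n * d + 8 * n * f ≤ 16 * n * f := by
    rw [le_div_iff₀ hd] at hmax
    nlinarith [mul_le_mul_of_nonneg_left hmax hn.le]
  have hlower : ∀ Qv Qf γv : ℝ, 1 ≤ Qv → 1 ≤ Qf → γv ≥ 1 / Qv →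
      2 * Qf * n * d + 8 * Qv * n * f * γv ≥ 8 * n * f := by
    intro Qv Qf γv hQv hQf hγ
    have hprod : 1 ≤ γv * Qv := (div_le_iff₀ (by linarith)).mp hγ
    have hQf_pos : 0 < Qf := by linarith
    have hcost : 0 < 2 * Qf * n * d := by positivity
    nlinarith [mul_le_mul_of_nonneg_left hprod (mul_pos hn hf).le]
  refine ⟨hupper, hlower, fun Qv Qf γv hQv hQf hγ => ?_⟩
  linarith [hlower Qv Qf γv hQv hQf hγ]
end
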